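/- arXiv:math/0410093 — 2 statements merged into one kernel-verified Lean document; each statement's English description precedes it below -/
import Mathlib

section
/- Let ω > 0 and Q > 0. For each integer n ≥ 2 let R_n* denote the infimum, over all measurable estimators δ : (ℕ → ℝ) → (ℕ → ℝ), of the supremum over θ ∈ H_ω^∞(Q) of the risk ∫ ∑'_{l} (δ(y)_l − θ_l)² dP_{θ,n}(y). Then lim_{n→∞} n (log n)^{−1/2} R_n* = 2√2 / ω. In particular the asymptotic minimax risk over H_ω^∞(Q) is 2√2 ω^{−1} n^{−1} (log n)^{1/2}, independently of Q. -/
open MeasureTheory ProbabilityTheory NNReal ENNReal Real Filter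

/-- Resampling one coordinate of a product measure does not change it. -/
lemma aux_update_map (μ : ℕ → Measure ℝ) [∀ i, IsProbabilityMeasure (μ i)] (l : ℕ) :
    ((Measure.infinitePi μ).prod (μ l)).map (fun p : (ℕ → ℝ) × ℝ => Function.update p.1 l p.2)
      = Measure.infinitePi μ := by
  have hm : Measurable (fun p : (ℕ → ℝ) × ℝ => Function.update p.1 l p.2) := by
    rw [measurable_pi_iff]
    intro i
    by_cases h : i = l
    · subst h; simpa using measurable_snd
    · simp only [Function.update_of_ne h]; fun_prop
  refine Measure.eq_infinitePi μ fun s t ht => ?_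
  have hms : MeasurableSet (Set.pi (s : Set ℕ) t) :=
    MeasurableSet.pi s.countable_toSet (fun i _ => ht i)
  rw [Measure.map_apply hm hms]
  have hpre : (fun p : (ℕ → ℝ) × ℝ => Function.update p.1 l p.2) ⁻¹' (Set.pi (s : Set ℕ) t)
      = (Set.pi ((s.erase l : Finset ℕ) : Set ℕ) t) ×ˢ (if l ∈ s then t l else Set.univ) := by
    ext ⟨x, u⟩
    simp only [Set.mem_preimage, Set.mem_pi, Set.mem_prod, Finset.mem_coe, Finset.mem_erase]
    constructor
    · intro h
      refine ⟨fun i hi => ?_, ?_⟩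
      · simpa [Function.update_of_ne hi.1] using h i hi.2
      · split_ifs with hl
        · simpa using h l hl
        · trivial
    · rintro ⟨h1, h2⟩ i hi
      by_cases h : i = l
      · subst h; simpa [hi] using h2
      · simpa [Function.update_of_ne h] using h1 i ⟨h, hi⟩
  rw [hpre, Measure.prod_prod, Measure.infinitePi_pi _ (fun i _ => ht i)]
  split_ifs with hl
  · exact Finset.prod_erase_mul s _ hl
  · simp [Finset.erase_eq_of_notMem hl]

lemma aux_measurable_update (l : ℕ) :
    Measurable (fun p : (ℕ → ℝ) × ℝ => Function.update p.1 l p.2) := by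
  rw [measurable_pi_iff]
  intro i
  by_cases h : i = l
  · subst h; simpa using measurable_snd
  · simp only [Function.update_of_ne h]; fun_prop

lemma aux_lintegral_update (μ : ℕ → Measure ℝ) [∀ i, IsProbabilityMeasure (μ i)] (l : ℕ)
    (F : (ℕ → ℝ) → ℝ≥0∞) (hF : Measurable F) :
    ∫⁻ x, F x ∂(Measure.infinitePi μ)
      = ∫⁻ x, ∫⁻ t, F (Function.update x l t) ∂(μ l) ∂(Measure.infinitePi μ) := by
  conv_lhs => rw [← aux_update_map μ l]
  rw [lintegral_map hF (aux_measurable_update l), lintegral_prod]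
  exact (hF.comp (aux_measurable_update l)).aemeasurable

/-- Standard normal. -/
noncomputable def auxG : Measure ℝ := gaussianReal 0 1

instance : IsProbabilityMeasure auxG := by unfold auxG; infer_instance

/-- Uniform law on `[-A, A]`. -/
noncomputable def auxU (A : ℝ) : Measure ℝ :=
  (ENNReal.ofReal (2 * A))⁻¹ • (volume.restrict (Set.Icc (-A) A))

lemma auxU_prob {A : ℝ} (hA : 0 < A) : IsProbabilityMeasure (auxU A) := by
  constructor
  simp only [auxU, Measure.smul_apply, Measure.restrict_apply MeasurableSet.univ, Set.univ_inter,
    Real.volume_Icc, smul_eq_mul]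
  rw [show A - -A = 2 * A by ring]
  exact ENNReal.inv_mul_cancel (by simpa using hA) ENNReal.ofReal_ne_top

lemma auxU_ae (A : ℝ) : ∀ᵐ t ∂(auxU A), t ∈ Set.Icc (-A) A := by
  unfold auxU
  exact Measure.ae_smul_measure (ae_restrict_mem measurableSet_Icc) _

/-- truncated second moment -/
noncomputable def auxI (C : ℝ) : ℝ≥0∞ :=
  ∫⁻ s in Set.Icc (-C) C, ENNReal.ofReal (s ^ 2) ∂auxG

lemma aux_sym (C h : ℝ) :
    auxI C ≤ ∫⁻ s in Set.Icc (-C) C, ENNReal.ofReal ((h + s) ^ 2) ∂auxG := by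
  have hneg : MeasurePreserving (fun x : ℝ => -x) (auxG.restrict (Set.Icc (-C) C))
      (auxG.restrict (Set.Icc (-C) C)) := by
    have h0 : MeasurePreserving (fun x : ℝ => -x) auxG auxG :=
      ⟨measurable_neg, by unfold auxG; simpa using gaussianReal_map_neg (μ := 0) (v := 1)⟩
    have := h0.restrict_preimage (s := Set.Icc (-C) C) measurableSet_Icc
    simpa using this
  have h1 : ∫⁻ s in Set.Icc (-C) C, ENNReal.ofReal ((h + s) ^ 2) ∂auxG
      = ∫⁻ s in Set.Icc (-C) C, ENNReal.ofReal ((h - s) ^ 2) ∂auxG := by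
    rw [← hneg.lintegral_comp (f := fun s => ENNReal.ofReal ((h + s) ^ 2)) (by fun_prop)]
    simp [sub_eq_add_neg]
  have h2 : 2 * auxI C ≤ 2 * ∫⁻ s in Set.Icc (-C) C, ENNReal.ofReal ((h + s) ^ 2) ∂auxG := by
    rw [two_mul (∫⁻ s in Set.Icc (-C) C, ENNReal.ofReal ((h + s) ^ 2) ∂auxG)]
    conv_rhs => rw [h1]
    conv_rhs => lhs; rw [← h1]
    rw [← lintegral_add_left (by fun_prop), auxI, ← lintegral_const_mul _ (by fun_prop)]
    refine lintegral_mono fun s => ?_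
    rw [← ENNReal.ofReal_add (by positivity) (by positivity),
      show (2 : ℝ≥0∞) = ENNReal.ofReal 2 by simp, ← ENNReal.ofReal_mul (by norm_num)]
    refine ENNReal.ofReal_le_ofReal ?_
    nlinarith [sq_nonneg h]
  exact (ENNReal.mul_le_mul_iff_right (by simp) (by simp)).1 h2

lemma aux_one_dim {A C : ℝ} (hC : 0 < C) (hCA : C < A) (g : ℝ → ℝ) (hg : Measurable g) :
    ENNReal.ofReal ((A - C) / A) * auxI C
      ≤ ∫⁻ t, ∫⁻ s, ENNReal.ofReal ((g (t + s) - t) ^ 2) ∂auxG ∂(auxU A) := by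
  have hA : 0 < A := hC.trans hCA
  have := auxU_prob hA
  have key : ENNReal.ofReal (2 * (A - C)) * auxI C
      ≤ ∫⁻ t in Set.Icc (-A) A, ∫⁻ s, ENNReal.ofReal ((g (t + s) - t) ^ 2) ∂auxG := by
    rw [lintegral_lintegral_swap (by fun_prop)]
    have hs : ∀ s ∈ Set.Icc (-C) C,
        ∫⁻ y in Set.Icc (-(A - C)) (A - C), ENNReal.ofReal ((g y - y + s) ^ 2)
        ≤ ∫⁻ t in Set.Icc (-A) A, ENNReal.ofReal ((g (t + s) - t) ^ 2) := by
      intro s hs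
      rw [← lintegral_indicator measurableSet_Icc, ← lintegral_indicator measurableSet_Icc]
      rw [← lintegral_add_right_eq_self _ s]
      refine lintegral_mono fun t => ?_
      simp only [Set.indicator]
      by_cases h : t + s ∈ Set.Icc (-(A - C)) (A - C)
      · have h' : t ∈ Set.Icc (-A) A := by
          simp only [Set.mem_Icc] at *
          constructor <;> linarith [hs.1, hs.2, h.1, h.2]
        rw [if_pos h, if_pos h']
        apply le_of_eq
        congr 2
        ring
      · rw [if_neg h]; exact zero_le
    calc ENNReal.ofReal (2 * (A - C)) * auxI C
        = ∫⁻ y in Set.Icc (-(A - C)) (A - C), auxI C := by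
          rw [setLIntegral_const, Real.volume_Icc, mul_comm]; congr 2; ring
      _ ≤ ∫⁻ y in Set.Icc (-(A - C)) (A - C), ∫⁻ s in Set.Icc (-C) C,
            ENNReal.ofReal ((g y - y + s) ^ 2) ∂auxG :=
          lintegral_mono fun y => aux_sym C (g y - y)
      _ = ∫⁻ s in Set.Icc (-C) C, ∫⁻ y in Set.Icc (-(A - C)) (A - C),
            ENNReal.ofReal ((g y - y + s) ^ 2) ∂volume ∂auxG := by
          rw [lintegral_lintegral_swap (by fun_prop)]
      _ ≤ ∫⁻ s in Set.Icc (-C) C, ∫⁻ t in Set.Icc (-A) A,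
            ENNReal.ofReal ((g (t + s) - t) ^ 2) ∂volume ∂auxG :=
          setLIntegral_mono' measurableSet_Icc hs
      _ ≤ _ := setLIntegral_le_lintegral _ _
  rw [auxU, lintegral_smul_measure, smul_eq_mul]
  refine le_trans (le_of_eq ?_) (mul_le_mul_right key _)
  rw [← mul_assoc, ← ENNReal.ofReal_inv_of_pos (by positivity), ← ENNReal.ofReal_mul (by positivity)]
  congr 2
  field_simp

lemma auxI_tendsto : Tendsto (fun k : ℕ => auxI (k : ℝ)) atTop (nhds 1) := by
  have h1 : ∫⁻ s, ENNReal.ofReal (s ^ 2) ∂auxG = 1 := by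
    have hv := variance_fun_id_gaussianReal (μ := 0) (v := 1)
    rw [variance_eq_integral measurable_id'.aemeasurable] at hv
    simp only [integral_id_gaussianReal, sub_zero] at hv
    rw [auxG, ← ofReal_integral_eq_lintegral_ofReal, hv]
    · simp
    · exact (memLp_id_gaussianReal 2).integrable_sq
    · exact ae_of_all _ fun x => sq_nonneg x
  have hm : Monotone (fun k : ℕ => Set.Icc (-(k : ℝ)) k) := by
    intro a b hab
    have : (a : ℝ) ≤ b := by exact_mod_cast hab
    exact Set.Icc_subset_Icc (by linarith) this
  have h2 := tendsto_measure_iUnion_atTop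
    (μ := auxG.withDensity (fun s => ENNReal.ofReal (s ^ 2))) hm
  have hU : (⋃ k : ℕ, Set.Icc (-(k : ℝ)) k) = Set.univ := by
    ext x
    obtain ⟨k, hk⟩ := exists_nat_ge |x|
    simp only [Set.mem_iUnion, Set.mem_univ, iff_true]
    exact ⟨k, abs_le.1 hk⟩
  rw [hU, withDensity_apply _ MeasurableSet.univ, Measure.restrict_univ, h1] at h2
  refine h2.congr fun k => ?_
  simp [auxI, withDensity_apply _ measurableSet_Icc]

lemma aux_bayes {A C : ℝ} (hC : 0 < C) (hCA : C < A) (N l : ℕ) (hl : l < N)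
    (h : (ℕ → ℝ) → ℝ) (hh : Measurable h) :
    ENNReal.ofReal ((A - C) / A) * auxI C ≤
      ∫⁻ τ, ∫⁻ z, ENNReal.ofReal ((h (fun i => (if i < N then τ i else 0) + z i) - τ l) ^ 2)
        ∂(Measure.infinitePi fun _ : ℕ => auxG) ∂(Measure.infinitePi fun _ : ℕ => auxU A) := by
  have := auxU_prob (hC.trans hCA)
  set Z := Measure.infinitePi fun _ : ℕ => auxG
  set T := Measure.infinitePi fun _ : ℕ => auxU A
  have hD : Measurable fun p : (ℕ → ℝ) × (ℕ → ℝ) =>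
      (fun i => (if i < N then p.1 i else 0) + p.2 i : ℕ → ℝ) := by
    rw [measurable_pi_iff]
    intro i
    by_cases hi : i < N
    · simp only [hi, if_true]; fun_prop
    · simp only [hi, if_false]; fun_prop
  set F : (ℕ → ℝ) × (ℕ → ℝ) → ℝ≥0∞ := fun p =>
    ENNReal.ofReal ((h (fun i => (if i < N then p.1 i else 0) + p.2 i) - p.1 l) ^ 2) with hFdef
  have hF : Measurable F :=
    ENNReal.measurable_ofReal.comp
      (((hh.comp hD).sub ((measurable_pi_apply l).comp measurable_fst)).pow_const 2)
  have hup := aux_measurable_update l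
  have e1 : ∫⁻ τ, ∫⁻ z, F (τ, z) ∂Z ∂T
      = ∫⁻ τ, ∫⁻ t, ∫⁻ z, ∫⁻ s, F (Function.update τ l t, Function.update z l s)
          ∂auxG ∂Z ∂(auxU A) ∂T := by
    rw [aux_lintegral_update (fun _ => auxU A) l (fun τ => ∫⁻ z, F (τ, z) ∂Z)
      hF.lintegral_prod_right']
    refine lintegral_congr fun τ => lintegral_congr fun t => ?_
    rw [aux_lintegral_update (fun _ => auxG) l (fun z => F (Function.update τ l t, z))
      (hF.comp measurable_prodMk_left)]
  change _ ≤ ∫⁻ τ, ∫⁻ z, F (τ, z) ∂Z ∂T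
  rw [e1]
  have hbig : ∀ τ, Measurable fun q : (ℝ × (ℕ → ℝ)) × ℝ =>
      F (Function.update τ l q.1.1, Function.update q.1.2 l q.2) := by
    intro τ
    refine hF.comp (Measurable.prodMk ?_ ?_)
    · exact hup.comp (measurable_const.prodMk (by fun_prop))
    · exact hup.comp (Measurable.prodMk (by fun_prop) (by fun_prop))
  have e2 : ∀ τ, ENNReal.ofReal ((A - C) / A) * auxI C ≤
      ∫⁻ t, ∫⁻ z, ∫⁻ s, F (Function.update τ l t, Function.update z l s) ∂auxG ∂Z ∂(auxU A) := by
    intro τ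
    rw [lintegral_lintegral_swap (hbig τ).lintegral_prod_right'.aemeasurable]
    have : ∀ z, ENNReal.ofReal ((A - C) / A) * auxI C ≤
        ∫⁻ t, ∫⁻ s, F (Function.update τ l t, Function.update z l s) ∂auxG ∂(auxU A) := by
      intro z
      set w : ℕ → ℝ := fun i => (if i < N then τ i else 0) + z i
      have hg : Measurable fun u : ℝ => h (Function.update w l u) :=
        hh.comp (hup.comp (measurable_const.prodMk measurable_id))
      refine (aux_one_dim hC hCA _ hg).trans (le_of_eq ?_)
      refine lintegral_congr fun t => lintegral_congr fun s => ?_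
      simp only [hFdef, Function.update_self]
      congr 4
      ext i
      by_cases hi : i = l
      · subst hi; simp [hl]
      · simp [Function.update_of_ne hi, w]
    calc _ = ∫⁻ z, ENNReal.ofReal ((A - C) / A) * auxI C ∂Z := by simp
      _ ≤ _ := lintegral_mono this
  calc _ = ∫⁻ τ, ENNReal.ofReal ((A - C) / A) * auxI C ∂T := by simp
      _ ≤ _ := lintegral_mono e2

lemma aux_P (P : (ℕ → ℝ) → ℕ → Measure (ℕ → ℝ))
    (hP : ∀ (θ : ℕ → ℝ) (n : ℕ), IsProjectiveLimit (P θ n)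
      (fun J : Finset ℕ => Measure.pi (fun j : J => gaussianReal (θ j) ((n : ℝ≥0))⁻¹)))
    (θ : ℕ → ℝ) (n : ℕ) :
    P θ n = (Measure.infinitePi fun _ : ℕ => auxG).map
      (fun z i => θ i + (Real.sqrt n)⁻¹ * z i) := by
  rw [(hP θ n).unique
    (Measure.isProjectiveLimit_infinitePi (fun i => gaussianReal (θ i) ((n : ℝ≥0))⁻¹))]
  rw [Measure.infinitePi_map_pi (fun _ : ℕ => auxG)
    (f := fun i (x : ℝ) => θ i + (Real.sqrt n)⁻¹ * x) (fun i => by fun_prop)]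
  congr 1
  ext1 i
  have h1 : Measure.map (fun x : ℝ => θ i + (Real.sqrt n)⁻¹ * x) auxG
      = ((auxG.map (fun x : ℝ => (Real.sqrt n)⁻¹ * x)).map (fun x => θ i + x)) := by
    rw [Measure.map_map (by fun_prop) (by fun_prop)]; rfl
  rw [h1, auxG, gaussianReal_map_const_mul, gaussianReal_map_const_add]
  congr 1
  · simp
  · ext; simp

lemma aux_risk (P : (ℕ → ℝ) → ℕ → Measure (ℕ → ℝ))
    (hP : ∀ (θ : ℕ → ℝ) (n : ℕ), IsProjectiveLimit (P θ n)
      (fun J : Finset ℕ => Measure.pi (fun j : J => gaussianReal (θ j) ((n : ℝ≥0))⁻¹)))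
    (θ : ℕ → ℝ) (n : ℕ) (δ : (ℕ → ℝ) → ℕ → ℝ) (hδ : Measurable δ) :
    ∫⁻ y, ∑' l : ℕ, ENNReal.ofReal ((δ y l - θ l) ^ 2) ∂(P θ n)
      = ∑' l : ℕ, ∫⁻ z, ENNReal.ofReal ((δ (fun i => θ i + (Real.sqrt n)⁻¹ * z i) l - θ l) ^ 2)
          ∂(Measure.infinitePi fun _ : ℕ => auxG) := by
  have hl : ∀ l, Measurable fun y => δ y l := fun l => (measurable_pi_apply l).comp hδ
  rw [aux_P P hP, lintegral_map, lintegral_tsum]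
  · intro l
    refine Measurable.aemeasurable ?_
    refine ENNReal.measurable_ofReal.comp (((hl l).comp ?_).sub_const _ |>.pow_const 2)
    fun_prop
  · refine Measurable.tsum fun l => ?_
    exact ENNReal.measurable_ofReal.comp (((hl l).sub_const _).pow_const 2)
  · fun_prop

lemma aux_lower (Q : ℝ) (β : ℕ → ℝ) (hβ : ∀ l, 0 ≤ β l)
    (P : (ℕ → ℝ) → ℕ → Measure (ℕ → ℝ))
    (hP : ∀ (θ : ℕ → ℝ) (n : ℕ), IsProjectiveLimit (P θ n)
      (fun J : Finset ℕ => Measure.pi (fun j : J => gaussianReal (θ j) ((n : ℝ≥0))⁻¹)))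
    {A C : ℝ} (hC : 0 < C) (hCA : C < A) (N n : ℕ) (hn : 0 < n)
    (hN : A ^ 2 / n * ∑ l ∈ Finset.range N, β l ≤ Q) :
    ENNReal.ofReal (1 / n) * (N * (ENNReal.ofReal ((A - C) / A) * auxI C)) ≤
      ⨅ (δ : (ℕ → ℝ) → ℕ → ℝ) (_ : Measurable δ),
          ⨆ θ ∈ {θ : ℕ → ℝ | Summable (fun l => β l * θ l ^ 2) ∧ ∑' l : ℕ, β l * θ l ^ 2 ≤ Q},
            ∫⁻ y, ∑' l : ℕ, ENNReal.ofReal ((δ y l - θ l) ^ 2) ∂(P θ n) := by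
  have := auxU_prob (hC.trans hCA)
  refine le_iInf₂ fun δ hδ => ?_
  set R := ⨆ θ ∈ {θ : ℕ → ℝ | Summable (fun l => β l * θ l ^ 2) ∧ ∑' l : ℕ, β l * θ l ^ 2 ≤ Q},
            ∫⁻ y, ∑' l : ℕ, ENNReal.ofReal ((δ y l - θ l) ^ 2) ∂(P θ n) with hR
  set Z := Measure.infinitePi fun _ : ℕ => auxG with hZ
  set T := Measure.infinitePi fun _ : ℕ => auxU A with hT
  set σ : ℝ := (Real.sqrt n)⁻¹ with hσ
  have hn' : (0 : ℝ) < n := by exact_mod_cast hn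
  have hσ0 : 0 < σ := by positivity
  have hσ2 : σ ^ 2 = 1 / n := by
    rw [hσ, inv_pow, Real.sq_sqrt hn'.le, one_div]
  set H : ℕ → (ℕ → ℝ) → ℝ := fun l w => σ⁻¹ * δ (fun i => σ * w i) l with hH
  have hHm : ∀ l, Measurable (H l) := by
    intro l
    refine Measurable.const_mul ?_ _
    exact (measurable_pi_apply l).comp (hδ.comp (by fun_prop))
  have hD : Measurable fun p : (ℕ → ℝ) × (ℕ → ℝ) =>
      (fun i => (if i < N then p.1 i else 0) + p.2 i : ℕ → ℝ) := by
    rw [measurable_pi_iff]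
    intro i
    by_cases hi : i < N
    · simp only [hi, if_true]; fun_prop
    · simp only [hi, if_false]; fun_prop
  set G : ℕ → (ℕ → ℝ) × (ℕ → ℝ) → ℝ≥0∞ := fun l p =>
    ENNReal.ofReal ((H l (fun i => (if i < N then p.1 i else 0) + p.2 i) - p.1 l) ^ 2) with hG
  have hGm : ∀ l, Measurable (G l) := fun l =>
    ENNReal.measurable_ofReal.comp
      ((((hHm l).comp hD).sub ((measurable_pi_apply l).comp measurable_fst)).pow_const 2)
  have hae : ∀ᵐ τ ∂T, ∀ l, τ l ∈ Set.Icc (-A) A := by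
    rw [ae_all_iff]
    intro l
    exact (measurePreserving_eval_infinitePi (fun _ : ℕ => auxU A) l).quasiMeasurePreserving.ae
      (auxU_ae A)
  have hpt : ∀ᵐ τ ∂T,
      ∑ l ∈ Finset.range N, ENNReal.ofReal (1 / n) * ∫⁻ z, G l (τ, z) ∂Z ≤ R := by
    filter_upwards [hae] with τ hτ
    set θ : ℕ → ℝ := fun i => if i < N then σ * τ i else 0 with hθ
    have hz : ∀ l ∉ Finset.range N, β l * θ l ^ 2 = 0 := by
      intro l hl
      have : ¬ l < N := by simpa using hl
      simp [hθ, this]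
    have hmem : θ ∈ {θ : ℕ → ℝ | Summable (fun l => β l * θ l ^ 2) ∧
        ∑' l : ℕ, β l * θ l ^ 2 ≤ Q} := by
      refine ⟨summable_of_ne_finset_zero hz, ?_⟩
      rw [tsum_eq_sum hz]
      refine le_trans ?_ hN
      rw [Finset.mul_sum]
      refine Finset.sum_le_sum fun l hl => ?_
      have hlN : l < N := by simpa using hl
      have h2 : τ l ^ 2 ≤ A ^ 2 := sq_le_sq' (hτ l).1 (hτ l).2
      have h3 : θ l ^ 2 = τ l ^ 2 / n := by
        simp only [hθ, hlN, if_true, mul_pow, hσ2]; ring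
      rw [h3, mul_comm (A ^ 2 / n)]
      exact mul_le_mul_of_nonneg_left (div_le_div_of_nonneg_right h2 hn'.le) (hβ l)
    refine le_trans ?_ (le_iSup₂ (f := fun θ (_ : θ ∈ {θ : ℕ → ℝ |
      Summable (fun l => β l * θ l ^ 2) ∧ ∑' l : ℕ, β l * θ l ^ 2 ≤ Q}) =>
      ∫⁻ y, ∑' l : ℕ, ENNReal.ofReal ((δ y l - θ l) ^ 2) ∂(P θ n)) θ hmem)
    rw [aux_risk P hP θ n δ hδ]
    refine le_trans (Finset.sum_le_sum fun l hl => ?_) (ENNReal.sum_le_tsum (Finset.range N))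
    have hlN : l < N := by simpa using hl
    have hGl : Measurable fun z => G l (τ, z) := (hGm l).comp measurable_prodMk_left
    rw [← lintegral_const_mul _ hGl]
    refine le_of_eq (lintegral_congr fun z => ?_)
    simp only [hG, hH]
    rw [← ENNReal.ofReal_mul (by positivity), ← hσ2, ← mul_pow]
    have e : (fun i => σ * ((if i < N then τ i else 0) + z i)) = fun i => θ i + σ * z i := by
      ext i
      simp only [hθ]
      split_ifs <;> ring
    have hθl : θ l = σ * τ l := by simp [hθ, hlN]
    rw [e, hθl, mul_sub, mul_inv_cancel_left₀ hσ0.ne']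
  calc ENNReal.ofReal (1 / n) * (N * (ENNReal.ofReal ((A - C) / A) * auxI C))
      = ∑ l ∈ Finset.range N, ENNReal.ofReal (1 / n) *
          (ENNReal.ofReal ((A - C) / A) * auxI C) := by
        rw [Finset.sum_const, Finset.card_range, nsmul_eq_mul]; ring
    _ ≤ ∑ l ∈ Finset.range N, ENNReal.ofReal (1 / n) * ∫⁻ τ, ∫⁻ z, G l (τ, z) ∂Z ∂T := by
        refine Finset.sum_le_sum fun l hl => ?_
        gcongr
        exact aux_bayes hC hCA N l (by simpa using hl) (H l) (hHm l)
    _ = ∫⁻ τ, ∑ l ∈ Finset.range N, ENNReal.ofReal (1 / n) * ∫⁻ z, G l (τ, z) ∂Z ∂T := by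
        rw [lintegral_finsetSum]
        · refine Finset.sum_congr rfl fun l _ => ?_
          rw [lintegral_const_mul _ (hGm l).lintegral_prod_right']
        · intro l _
          exact (hGm l).lintegral_prod_right'.const_mul _
    _ ≤ ∫⁻ τ, R ∂T := lintegral_mono_ae hpt
    _ = R := by simp

lemma aux_upper (Q : ℝ) (hQ : 0 < Q) (β : ℕ → ℝ) (hβ : ∀ l, 0 ≤ β l)
    (P : (ℕ → ℝ) → ℕ → Measure (ℕ → ℝ))
    (hP : ∀ (θ : ℕ → ℝ) (n : ℕ), IsProjectiveLimit (P θ n)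
      (fun J : Finset ℕ => Measure.pi (fun j : J => gaussianReal (θ j) ((n : ℝ≥0))⁻¹)))
    (N n : ℕ) (hn : 0 < n) (hN : ∀ l, N ≤ l → (n : ℝ) ≤ β l) :
      (⨅ (δ : (ℕ → ℝ) → ℕ → ℝ) (_ : Measurable δ),
          ⨆ θ ∈ {θ : ℕ → ℝ | Summable (fun l => β l * θ l ^ 2) ∧ ∑' l : ℕ, β l * θ l ^ 2 ≤ Q},
            ∫⁻ y, ∑' l : ℕ, ENNReal.ofReal ((δ y l - θ l) ^ 2) ∂(P θ n))
      ≤ ENNReal.ofReal ((N + Q) / n) := by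
  have hn' : (0 : ℝ) < n := by exact_mod_cast hn
  have hσ2 : ((Real.sqrt n)⁻¹) ^ 2 = 1 / n := by
    rw [inv_pow, Real.sq_sqrt hn'.le, one_div]
  have hm2 : ∫⁻ s, ENNReal.ofReal (s ^ 2) ∂auxG ≤ 1 := by
    have hv := variance_fun_id_gaussianReal (μ := 0) (v := 1)
    rw [variance_eq_integral measurable_id'.aemeasurable] at hv
    simp only [integral_id_gaussianReal, sub_zero] at hv
    rw [auxG, ← ofReal_integral_eq_lintegral_ofReal, hv]
    · simp
    · exact (memLp_id_gaussianReal 2).integrable_sq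
    · exact ae_of_all _ fun x => sq_nonneg x
  set δ : (ℕ → ℝ) → ℕ → ℝ := fun y l => if l < N then y l else 0 with hδdef
  have hδ : Measurable δ := by
    rw [measurable_pi_iff]
    intro i
    by_cases hi : i < N
    · simp only [hδdef, hi, if_true]; fun_prop
    · simp only [hδdef, hi, if_false]; fun_prop
  refine (iInf₂_le δ hδ).trans (iSup₂_le fun θ hθ => ?_)
  rw [aux_risk P hP θ n δ hδ]
  have hterm : ∀ l, ∫⁻ z, ENNReal.ofReal ((δ (fun i => θ i + (Real.sqrt n)⁻¹ * z i) l - θ l) ^ 2)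
          ∂(Measure.infinitePi fun _ : ℕ => auxG)
        ≤ (if l ∈ Finset.range N then ENNReal.ofReal (1 / n) else 0)
          + ENNReal.ofReal (β l * θ l ^ 2 / n) := by
    intro l
    by_cases hl : l < N
    · refine le_add_right ?_
      simp only [hδdef, hl, if_true, Finset.mem_range, add_sub_cancel_left, mul_pow, hσ2]
      have e : ∀ z : ℕ → ℝ, ENNReal.ofReal (1 / n * z l ^ 2)
          = ENNReal.ofReal (1 / n) * ENNReal.ofReal (z l ^ 2) :=
        fun z => ENNReal.ofReal_mul (by positivity)
      simp_rw [e]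
      rw [lintegral_const_mul _ (by fun_prop)]
      have := (measurePreserving_eval_infinitePi (fun _ : ℕ => auxG) l).lintegral_comp
        (f := fun s => ENNReal.ofReal (s ^ 2)) (by fun_prop)
      simp only [Function.eval] at this
      rw [this]
      exact (mul_le_mul_right hm2 _).trans (by simp)
    · refine le_add_left ?_
      simp only [hδdef, hl, if_false, zero_sub, neg_sq, lintegral_const, measure_univ, mul_one]
      refine ENNReal.ofReal_le_ofReal ?_
      rw [le_div_iff₀ hn', mul_comm]
      exact mul_le_mul_of_nonneg_right (hN l (not_lt.1 hl)) (sq_nonneg _)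
  refine (ENNReal.tsum_le_tsum hterm).trans ?_
  rw [ENNReal.tsum_add]
  have h1 : ∑' l : ℕ, (if l ∈ Finset.range N then ENNReal.ofReal (1 / n) else 0)
      = ENNReal.ofReal (N / n) := by
    rw [tsum_eq_sum (s := Finset.range N) (fun l hl => if_neg hl)]
    rw [Finset.sum_congr rfl (fun l hl => if_pos hl), Finset.sum_const, Finset.card_range,
      nsmul_eq_mul, ← ENNReal.ofReal_natCast, ← ENNReal.ofReal_mul (by positivity)]
    congr 1; ring
  have h2 : ∑' l : ℕ, ENNReal.ofReal (β l * θ l ^ 2 / n) ≤ ENNReal.ofReal (Q / n) := by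
    rw [← ENNReal.ofReal_tsum_of_nonneg (fun l => div_nonneg (mul_nonneg (hβ l) (sq_nonneg _)) hn'.le)
      (hθ.1.div_const _), tsum_div_const]
    exact ENNReal.ofReal_le_ofReal (div_le_div_of_nonneg_right hθ.2 hn'.le)
  rw [h1, add_div, ENNReal.ofReal_add (by positivity) (by positivity)]
  gcongr

/-- **Theorem 1.** The minimax risk over the infinite-order Sobolev ellipsoid
`H_ω^∞(Q) = {θ : ∑ β_l θ_l² ≤ Q}`, `β_0 = 1`, `β_{2l-1} = β_{2l} = e^{l²ω²/2}`, in the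
Gaussian sequence model `y_l = θ_l + ε_l` with `ε_l` i.i.d. `N(0, 1/n)` (formalized by `P θ n`
being the projective limit of the finite products of the Gaussian coordinate laws), satisfies
`R_n* ∼ 2√2 ω⁻¹ n⁻¹ (log n)^{1/2}`; in particular the limit does not depend on `Q`. -/
theorem stmt_0 (ω Q : ℝ) (hω : 0 < ω) (hQ : 0 < Q)
    (β : ℕ → ℝ) (hβ0 : β 0 = 1)
    (hβodd : ∀ l : ℕ, 1 ≤ l → β (2 * l - 1) = Real.exp ((l : ℝ) ^ 2 * ω ^ 2 / 2))
    (hβeven : ∀ l : ℕ, 1 ≤ l → β (2 * l) = Real.exp ((l : ℝ) ^ 2 * ω ^ 2 / 2))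
    (P : (ℕ → ℝ) → ℕ → Measure (ℕ → ℝ))
    (hP : ∀ (θ : ℕ → ℝ) (n : ℕ), IsProjectiveLimit (P θ n)
      (fun J : Finset ℕ => Measure.pi (fun j : J => gaussianReal (θ j) ((n : ℝ≥0))⁻¹))) :
    Tendsto (fun n : ℕ => ENNReal.ofReal ((n : ℝ) / Real.sqrt (Real.log n)) *
        ⨅ (δ : (ℕ → ℝ) → ℕ → ℝ) (_ : Measurable δ),
          ⨆ θ ∈ {θ : ℕ → ℝ | Summable (fun l => β l * θ l ^ 2) ∧ ∑' l : ℕ, β l * θ l ^ 2 ≤ Q},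
            ∫⁻ y, ∑' l : ℕ, ENNReal.ofReal ((δ y l - θ l) ^ 2) ∂(P θ n))
      atTop (nhds (ENNReal.ofReal (2 * Real.sqrt 2 / ω))) := by
  have hβ : ∀ l, β l = Real.exp ((((l + 1) / 2 : ℕ) : ℝ) ^ 2 * ω ^ 2 / 2) := by
    intro l
    rcases Nat.even_or_odd' l with ⟨k, rfl | rfl⟩
    · rcases Nat.eq_zero_or_pos k with rfl | hk
      · simp [hβ0]
      · rw [hβeven k hk, show (2 * k + 1) / 2 = k by omega]
    · have := hβodd (k + 1) (by omega)
      rw [show 2 * (k + 1) - 1 = 2 * k + 1 by omega] at this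
      rw [this, show (2 * k + 1 + 1) / 2 = k + 1 by omega]
  have hβpos : ∀ l, 0 ≤ β l := fun l => by rw [hβ]; positivity
  set x : ℕ → ℝ := fun n => Real.sqrt (Real.log n) with hx
  have hxt : Tendsto x atTop atTop :=
    Real.tendsto_sqrt_atTop.comp (Real.tendsto_log_atTop.comp tendsto_natCast_atTop_atTop)
  set L : ℝ := 2 * Real.sqrt 2 / ω with hL
  have hs2 : Real.sqrt 2 ^ 2 = 2 := Real.sq_sqrt (by norm_num)
  have hx2 : ∀ n : ℕ, 0 < n → x n ^ 2 = Real.log n := fun n hn =>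
    Real.sq_sqrt (Real.log_nonneg (by exact_mod_cast hn))
  rw [tendsto_order]
  constructor
  · intro b hb
    -- choose the tuning parameter
    have hk0 : Tendsto (fun k : ℕ => (1 : ℝ) / k) atTop (nhds 0) := tendsto_one_div_atTop_nhds_zero_nat
    have hk1 : Tendsto (fun k : ℕ => ENNReal.ofReal (L * Real.sqrt (1 - 1 / k)) *
        (ENNReal.ofReal (1 - 1 / (k : ℝ)) * auxI k)) atTop (nhds (ENNReal.ofReal L)) := by
      have h1 : Tendsto (fun k : ℕ => 1 - 1 / (k : ℝ)) atTop (nhds 1) := by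
        simpa using hk0.const_sub 1
      have h2 : Tendsto (fun k : ℕ => ENNReal.ofReal (L * Real.sqrt (1 - 1 / k))) atTop
          (nhds (ENNReal.ofReal L)) := by
        have := ENNReal.tendsto_ofReal (h1.sqrt.const_mul L)
        simpa using this
      have h3 := ENNReal.tendsto_ofReal h1
      have h4 := ENNReal.Tendsto.mul h3 (by simp) auxI_tendsto (by simp)
      have h5 := ENNReal.Tendsto.mul h2 (by simp) h4 (by simp)
      simpa using h5
    obtain ⟨k, hkb, hk2⟩ := ((hk1.eventually (lt_mem_nhds hb)).and (eventually_ge_atTop 2)).exists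
    have hk2' : (2 : ℝ) ≤ k := by exact_mod_cast hk2
    set ε : ℝ := 1 / k with hε
    have hε0 : 0 < ε := by positivity
    have hε1 : ε < 1 := by rw [hε, div_lt_one (by linarith)]; linarith
    set c : ℝ := Real.sqrt 2 * Real.sqrt (1 - ε) / ω with hc
    have hc0 : 0 ≤ c := by positivity
    have hc2 : c ^ 2 * ω ^ 2 / 2 = 1 - ε := by
      rw [hc, div_pow, mul_pow, hs2, Real.sq_sqrt (by linarith)]; field_simp
    set A : ℝ := (k : ℝ) ^ 2 with hA
    have hCA : (k : ℝ) < A := by rw [hA]; nlinarith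
    have hA0 : 0 < A := by linarith
    have hr : (A - k) / A = 1 - ε := by rw [hA, hε]; field_simp
    set M : ℕ → ℕ := fun n => ⌊c * x n⌋₊ with hM
    have hlim : Tendsto (fun n : ℕ => ENNReal.ofReal ((2 * M n + 1) / x n) *
        (ENNReal.ofReal (1 - ε) * auxI k)) atTop
        (nhds (ENNReal.ofReal (L * Real.sqrt (1 - ε)) * (ENNReal.ofReal (1 - ε) * auxI k))) := by
      have h1 : Tendsto (fun n => (M n : ℝ) / x n) atTop (nhds c) :=
        (tendsto_nat_floor_mul_div_atTop hc0).comp hxt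
      have h2 : Tendsto (fun n => 2 * ((M n : ℝ) / x n) + (x n)⁻¹) atTop
          (nhds (L * Real.sqrt (1 - ε))) := by
        have := (h1.const_mul 2).add (tendsto_inv_atTop_zero.comp hxt)
        refine Eq.mp (congrArg (fun w => Tendsto _ _ (nhds w)) ?_) this
        rw [hc, hL]; ring
      have hI : auxI k ≠ ∞ := by
        have hv : ∫⁻ s, ENNReal.ofReal (s ^ 2) ∂auxG < ∞ := by
          have := (memLp_id_gaussianReal (μ := 0) (v := 1) 2).integrable_sq
          exact this.lintegral_lt_top
        exact ((setLIntegral_le_lintegral _ _).trans_lt hv).ne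
      refine ENNReal.Tendsto.mul_const ?_ (Or.inr (ENNReal.mul_ne_top (by simp) hI))
      refine ENNReal.tendsto_ofReal (h2.congr fun n => ?_)
      ring
    filter_upwards [hlim.eventually (lt_mem_nhds hkb), eventually_gt_atTop 1,
      hxt.eventually_ge_atTop 1, hxt.eventually_ge_atTop (A ^ 2 * (2 * c + 1) / (Q * ε))]
      with n hnb hn1 hxn1 hxn2
    have hn : 0 < n := by omega
    have hn' : (0 : ℝ) < n := by exact_mod_cast hn
    refine hnb.trans_le ?_
    have hbound : A ^ 2 / n * ∑ l ∈ Finset.range (2 * M n + 1), β l ≤ Q := by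
      have hMle : (M n : ℝ) ≤ c * x n := Nat.floor_le (by positivity)
      have hβle : ∀ l ∈ Finset.range (2 * M n + 1), β l ≤ Real.exp ((1 - ε) * x n ^ 2) := by
        intro l hl
        have hl' : l < 2 * M n + 1 := by simpa using hl
        have h1 : (l + 1) / 2 ≤ M n := by omega
        have h2 : (((l + 1) / 2 : ℕ) : ℝ) ≤ c * x n := le_trans (by exact_mod_cast h1) hMle
        rw [hβ, ← hc2]
        refine Real.exp_le_exp.2 ?_
        have h3 : (((l + 1) / 2 : ℕ) : ℝ) ^ 2 ≤ (c * x n) ^ 2 :=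
          pow_le_pow_left₀ (Nat.cast_nonneg _) h2 2
        have h4 := mul_le_mul_of_nonneg_right h3 (sq_nonneg ω)
        nlinarith
      have hsum := Finset.sum_le_card_nsmul _ _ _ hβle
      rw [Finset.card_range, nsmul_eq_mul] at hsum
      push_cast at hsum
      have hexp : (n : ℝ) = Real.exp ((1 - ε) * x n ^ 2) * Real.exp (ε * x n ^ 2) := by
        rw [← Real.exp_add, show (1 - ε) * x n ^ 2 + ε * x n ^ 2 = x n ^ 2 by ring, hx2 n hn,
          Real.exp_log hn']
      set E := Real.exp ((1 - ε) * x n ^ 2) with hE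
      have hE0 : 0 < E := Real.exp_pos _
      have h5 : ε * x n ^ 2 ≤ Real.exp (ε * x n ^ 2) := by
        have := Real.add_one_le_exp (ε * x n ^ 2); linarith
      have h6 : A ^ 2 * (2 * c + 1) ≤ x n * (Q * ε) := (div_le_iff₀ (by positivity)).1 hxn2
      have h7 : A ^ 2 * (2 * (M n : ℝ) + 1) ≤ Q * (ε * x n ^ 2) := by
        have h8 : 2 * (M n : ℝ) + 1 ≤ (2 * c + 1) * x n := by nlinarith
        calc A ^ 2 * (2 * (M n : ℝ) + 1) ≤ A ^ 2 * ((2 * c + 1) * x n) := by gcongr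
          _ = (A ^ 2 * (2 * c + 1)) * x n := by ring
          _ ≤ (x n * (Q * ε)) * x n := by gcongr
          _ = _ := by ring
      rw [div_mul_eq_mul_div, div_le_iff₀ hn']
      calc A ^ 2 * ∑ l ∈ Finset.range (2 * M n + 1), β l
          ≤ A ^ 2 * ((2 * (M n : ℝ) + 1) * E) := by gcongr
        _ = (A ^ 2 * (2 * (M n : ℝ) + 1)) * E := by ring
        _ ≤ (Q * Real.exp (ε * x n ^ 2)) * E :=
            mul_le_mul_of_nonneg_right (h7.trans (mul_le_mul_of_nonneg_left h5 hQ.le)) hE0.le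
        _ = Q * n := by rw [hexp]; ring
    have hlow := aux_lower Q β hβpos P hP (by linarith : (0 : ℝ) < k) hCA (2 * M n + 1) n hn hbound
    rw [hr] at hlow
    refine le_trans (le_of_eq ?_) (mul_le_mul_right hlow _)
    have hx0 : x n ≠ 0 := by linarith
    have hcoef : ENNReal.ofReal ((2 * M n + 1) / x n) = ENNReal.ofReal (n / Real.sqrt (Real.log n)) *
        (ENNReal.ofReal (1 / n) * ((2 * M n + 1 : ℕ) : ℝ≥0∞)) := by
      rw [← ENNReal.ofReal_natCast, ← ENNReal.ofReal_mul (by positivity),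
        ← ENNReal.ofReal_mul (by positivity)]
      congr 1
      push_cast
      change _ = n / x n * _
      field_simp
    rw [hcoef]
    ring
  · intro b hb
    set c : ℝ := Real.sqrt 2 / ω with hc
    have hc0 : 0 ≤ c := by positivity
    have hc2 : c ^ 2 * ω ^ 2 / 2 = 1 := by
      rw [hc, div_pow, hs2]; field_simp
    set M : ℕ → ℕ := fun n => ⌈c * x n⌉₊ with hM
    have hlim : Tendsto (fun n : ℕ => ENNReal.ofReal ((2 * M n + 1 + Q) / x n)) atTop
        (nhds (ENNReal.ofReal L)) := by
      have h1 : Tendsto (fun n => (M n : ℝ) / x n) atTop (nhds c) :=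
        (tendsto_nat_ceil_mul_div_atTop hc0).comp hxt
      have h2 : Tendsto (fun n => 2 * ((M n : ℝ) / x n) + (1 + Q) * (x n)⁻¹) atTop (nhds L) := by
        have := (h1.const_mul 2).add ((tendsto_inv_atTop_zero.comp hxt).const_mul (1 + Q))
        refine Eq.mp (congrArg (fun w => Tendsto _ _ (nhds w)) ?_) this
        rw [hc, hL]; ring
      refine ENNReal.tendsto_ofReal (h2.congr fun n => ?_)
      ring
    filter_upwards [hlim.eventually (gt_mem_nhds hb), eventually_gt_atTop 1,
      hxt.eventually_ge_atTop 1] with n hnb hn1 hxn1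
    have hn : 0 < n := by omega
    have hn' : (0 : ℝ) < n := by exact_mod_cast hn
    refine lt_of_le_of_lt ?_ hnb
    have hup := aux_upper Q hQ β hβpos P hP (2 * M n + 1) n hn (by
      intro l hl
      have h1 : M n ≤ (l + 1) / 2 := by omega
      have h2 : c * x n ≤ (((l + 1) / 2 : ℕ) : ℝ) :=
        (Nat.le_ceil _).trans (by exact_mod_cast h1)
      rw [hβ, ← Real.log_le_iff_le_exp hn', ← hx2 n hn]
      have h3 : (c * x n) ^ 2 ≤ (((l + 1) / 2 : ℕ) : ℝ) ^ 2 :=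
        pow_le_pow_left₀ (by positivity) h2 2
      have h4 := mul_le_mul_of_nonneg_right h3 (sq_nonneg ω)
      have h5 : x n ^ 2 = (c * x n) ^ 2 * ω ^ 2 / 2 := by
        rw [mul_pow, show c ^ 2 * x n ^ 2 * ω ^ 2 / 2 = (c ^ 2 * ω ^ 2 / 2) * x n ^ 2 by ring,
          hc2, one_mul]
      rw [h5]; linarith)
    refine (mul_le_mul_right hup _).trans (le_of_eq ?_)
    rw [← ENNReal.ofReal_mul (by positivity)]
    congr 1
    have : x n ≠ 0 := by linarith
    push_cast
    change n / x n * _ = _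
    field_simp
end

section
/- Let ω > 0, Q > 0 and let m ≥ 1 be a real number. Then lim_{n→∞} n^{2m/(2m+1)} · inf_{λ > 0} sup_{θ ∈ H^m(Q)} R_n(λ, θ) = (2m+1) m^{−2m/(2m+1)} Q^{1/(2m+1)}. Moreover, if (λ_n) is a sequence in (0,1) satisfying log(1/λ_n)/ω² ∼ (m n Q)^{2/(2m+1)}/2 (i.e. the ratio of the two sides tends to 1), then lim_{n→∞} n^{2m/(2m+1)} · sup_{θ ∈ H^m(Q)} R_n(λ_n, θ) = (2m+1) m^{−2m/(2m+1)} Q^{1/(2m+1)}. -/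
open Real Filter

/-- The ellipsoid `{θ : ∑ ρ_l θ_l² ≤ Q}` of square sequences. -/
def ellipsoid (ρ : ℕ → ℝ) (Q : ℝ) : Set (ℕ → ℝ) :=
  {θ | Summable (fun l => ρ l * θ l ^ 2) ∧ ∑' l : ℕ, ρ l * θ l ^ 2 ≤ Q}

/-- The risk `R_n(λ, θ)` of the periodic Gaussian regularization estimator
`θ̂_l = (1 + λ β_l)⁻¹ y_l` in the Gaussian sequence model with noise variance `1/n`. -/
noncomputable def regRisk (β : ℕ → ℝ) (n : ℕ) (lam : ℝ) (θ : ℕ → ℝ) : ℝ :=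
  (1 / n) * ∑' l : ℕ, ((1 + lam * β l) ^ 2)⁻¹ +
    ∑' l : ℕ, (lam * β l / (1 + lam * β l)) ^ 2 * θ l ^ 2

/-- Frequency attached to the index `j`. -/
def kk (j : ℕ) : ℕ := (j + 1) / 2

noncomputable def bet (ω : ℝ) (j : ℕ) : ℝ := Real.exp ((kk j : ℝ) ^ 2 * ω ^ 2 / 2)

noncomputable def rho (m : ℝ) (j : ℕ) : ℝ := 1 + (kk j : ℝ) ^ (2 * m)

noncomputable def VV (ω lam : ℝ) : ℝ := ∑' j : ℕ, ((1 + lam * bet ω j) ^ 2)⁻¹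

noncomputable def aa (ω m lam : ℝ) (j : ℕ) : ℝ :=
  (lam * bet ω j / (1 + lam * bet ω j)) ^ 2 / rho m j

noncomputable def BB (ω m lam : ℝ) : ℝ := ⨆ j, aa ω m lam j

noncomputable def lamK (ω K : ℝ) : ℝ := Real.exp (-(K ^ 2 * ω ^ 2 / 2))

lemma kk_lower (j : ℕ) : (j : ℝ) / 2 ≤ kk j := by
  have : j ≤ 2 * kk j := by unfold kk; omega
  have : (j : ℝ) ≤ 2 * kk j := by exact_mod_cast this
  linarith

lemma kk_upper (j : ℕ) : (kk j : ℝ) ≤ ((j : ℝ) + 1) / 2 := by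
  have : 2 * kk j ≤ j + 1 := by unfold kk; omega
  have : 2 * (kk j : ℝ) ≤ j + 1 := by exact_mod_cast this
  linarith

lemma bet_pos (ω : ℝ) (j : ℕ) : 0 < bet ω j := Real.exp_pos _

lemma rho_ge_one (m : ℝ) (j : ℕ) : 1 ≤ rho m j := by
  unfold rho
  have : (0 : ℝ) ≤ (kk j : ℝ) ^ (2 * m) := by positivity
  linarith

lemma ratio_nonneg {ω lam : ℝ} (h : 0 < lam) (j : ℕ) :
    0 ≤ lam * bet ω j / (1 + lam * bet ω j) := by
  have := mul_pos h (bet_pos ω j)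
  positivity

lemma ratio_le_one {ω lam : ℝ} (h : 0 < lam) (j : ℕ) :
    lam * bet ω j / (1 + lam * bet ω j) ≤ 1 := by
  have := mul_pos h (bet_pos ω j)
  rw [div_le_one (by positivity)]
  linarith

lemma aa_le_one {ω m lam : ℝ} (h : 0 < lam) (j : ℕ) : aa ω m lam j ≤ 1 := by
  unfold aa
  have h1 := rho_ge_one m j
  rw [div_le_one (by linarith)]
  have := pow_le_one₀ (n := 2) (ratio_nonneg (ω := ω) h j) (ratio_le_one h j)
  linarith

lemma aa_nonneg {ω m lam : ℝ} (j : ℕ) : 0 ≤ aa ω m lam j := by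
  unfold aa
  have h1 := rho_ge_one m j
  positivity

lemma aa_bdd {ω m lam : ℝ} (h : 0 < lam) : BddAbove (Set.range (aa ω m lam)) :=
  ⟨1, by rintro _ ⟨j, rfl⟩; exact aa_le_one h j⟩

lemma aa_le_BB {ω m lam : ℝ} (h : 0 < lam) (j : ℕ) : aa ω m lam j ≤ BB ω m lam :=
  le_ciSup (aa_bdd h) j

lemma VV_nonneg (ω lam : ℝ) : 0 ≤ VV ω lam := tsum_nonneg fun j => by positivity

lemma BB_nonneg {ω m lam : ℝ} (h : 0 < lam) : 0 ≤ BB ω m lam :=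
  (aa_nonneg 0).trans (aa_le_BB h 0)

lemma risk_le {ω m lam Q : ℝ} (h : 0 < lam) (n : ℕ) (θ : ℕ → ℝ)
    (hθ : θ ∈ ellipsoid (rho m) Q) :
    regRisk (bet ω) n lam θ ≤ (1 / n) * VV ω lam + Q * BB ω m lam := by
  obtain ⟨hs, hq⟩ := hθ
  unfold regRisk
  have key : ∀ l, (lam * bet ω l / (1 + lam * bet ω l)) ^ 2 * θ l ^ 2
      ≤ BB ω m lam * (rho m l * θ l ^ 2) := by
    intro l
    have h1 := rho_ge_one m l
    have h2 : (lam * bet ω l / (1 + lam * bet ω l)) ^ 2 = aa ω m lam l * rho m l := by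
      unfold aa; field_simp
    rw [h2, mul_assoc]
    exact mul_le_mul_of_nonneg_right (aa_le_BB h l) (by positivity)
  have hs2 := hs.mul_left (BB ω m lam)
  have hs1 := Summable.of_nonneg_of_le (fun l => by positivity) key hs2
  have := hs1.tsum_le_tsum key hs2
  rw [tsum_mul_left] at this
  have h3 := mul_le_mul_of_nonneg_left hq (BB_nonneg (ω := ω) (m := m) h)
  unfold VV
  linarith

lemma risk_nonneg {ω lam : ℝ} (n : ℕ) (θ : ℕ → ℝ) : 0 ≤ regRisk (bet ω) n lam θ := by
  unfold regRisk
  have h1 : 0 ≤ ∑' l : ℕ, ((1 + lam * bet ω l) ^ 2)⁻¹ := tsum_nonneg fun j => by positivity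
  have h2 : 0 ≤ ∑' l : ℕ, (lam * bet ω l / (1 + lam * bet ω l)) ^ 2 * θ l ^ 2 :=
    tsum_nonneg fun j => by positivity
  positivity

lemma risk_spike {ω m lam Q : ℝ} (hQ : 0 < Q) (n : ℕ) (j : ℕ) :
    ∃ θ ∈ ellipsoid (rho m) Q,
      regRisk (bet ω) n lam θ = (1 / n) * VV ω lam + Q * aa ω m lam j := by
  have h1 := rho_ge_one m j
  have hsq : √(Q / rho m j) ^ 2 = Q / rho m j := Real.sq_sqrt (by positivity)
  refine ⟨Pi.single j (√(Q / rho m j)), ?_, ?_⟩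
  · have : HasSum (fun l => rho m l * (Pi.single j (√(Q / rho m j)) : ℕ → ℝ) l ^ 2)
        (rho m j * (Pi.single j (√(Q / rho m j)) : ℕ → ℝ) j ^ 2) :=
      hasSum_single j (fun l hl => by simp [Pi.single_eq_of_ne hl])
    refine ⟨this.summable, ?_⟩
    rw [this.tsum_eq, Pi.single_eq_same, hsq]
    field_simp; rfl
  · unfold regRisk
    have : ∑' l : ℕ, (lam * bet ω l / (1 + lam * bet ω l)) ^ 2 *
        (Pi.single j (√(Q / rho m j)) : ℕ → ℝ) l ^ 2 =
        (lam * bet ω j / (1 + lam * bet ω j)) ^ 2 *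
        (Pi.single j (√(Q / rho m j)) : ℕ → ℝ) j ^ 2 :=
      tsum_eq_single j (fun l hl => by simp [Pi.single_eq_of_ne hl])
    rw [this, Pi.single_eq_same, hsq]
    unfold VV aa
    ring

lemma sup_risk {ω m lam Q : ℝ} (hQ : 0 < Q) (h : 0 < lam) (n : ℕ) :
    (⨆ θ ∈ ellipsoid (rho m) Q, regRisk (bet ω) n lam θ)
      = (1 / n) * VV ω lam + Q * BB ω m lam := by
  have hnn : 0 ≤ (1 / (n : ℝ)) * VV ω lam + Q * BB ω m lam := by
    have := VV_nonneg ω lam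
    have := BB_nonneg (ω := ω) (m := m) h
    positivity
  have hle : ∀ θ, (⨆ (_ : θ ∈ ellipsoid (rho m) Q), regRisk (bet ω) n lam θ)
      ≤ (1 / n) * VV ω lam + Q * BB ω m lam := by
    intro θ
    by_cases hθ : θ ∈ ellipsoid (rho m) Q
    · simp only [hθ, ciSup_unique]
      exact risk_le h n θ hθ
    · simp only [hθ, Real.iSup_of_isEmpty]
      exact hnn
  apply le_antisymm (ciSup_le hle)
  have hb : BddAbove (Set.range fun θ =>
      (⨆ (_ : θ ∈ ellipsoid (rho m) Q), regRisk (bet ω) n lam θ)) :=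
    ⟨_, by rintro _ ⟨θ, rfl⟩; exact hle θ⟩
  set S := ⨆ θ ∈ ellipsoid (rho m) Q, regRisk (bet ω) n lam θ with hS
  have hj : ∀ j, aa ω m lam j ≤ (S - (1 / n) * VV ω lam) / Q := by
    intro j
    obtain ⟨θ, hθ, he⟩ := risk_spike (ω := ω) (m := m) (lam := lam) hQ n j
    have := le_ciSup hb θ
    simp only [hθ, ciSup_unique] at this
    rw [he] at this
    rw [le_div_iff₀ hQ]
    linarith
  have := ciSup_le hj
  rw [le_div_iff₀ hQ] at this
  unfold BB
  linarith

lemma lamK_pos (ω K : ℝ) : 0 < lamK ω K := Real.exp_pos _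

lemma lamK_mul (ω K : ℝ) (j : ℕ) :
    lamK ω K * bet ω j = Real.exp (((kk j : ℝ) ^ 2 - K ^ 2) * ω ^ 2 / 2) := by
  unfold lamK bet
  rw [← Real.exp_add]
  congr 1; ring

lemma term_le_one (ω K : ℝ) (j : ℕ) : ((1 + lamK ω K * bet ω j) ^ 2)⁻¹ ≤ 1 := by
  have := mul_pos (lamK_pos ω K) (bet_pos ω j)
  apply inv_le_one_of_one_le₀
  nlinarith

lemma term_le {ω K : ℝ} (hK : 1 ≤ K) (j : ℕ) :
    ((1 + lamK ω K * bet ω j) ^ 2)⁻¹ ≤ Real.exp (-(ω ^ 2 * ((j : ℝ) / 2 - K))) := by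
  by_cases hj : (j : ℝ) / 2 ≤ K
  · refine (term_le_one ω K j).trans (Real.one_le_exp ?_)
    have : 0 ≤ ω ^ 2 * (K - (j : ℝ) / 2) := mul_nonneg (by positivity) (by linarith)
    linarith
  · push Not at hj
    have hk := kk_lower j
    rw [lamK_mul, Real.exp_neg]
    apply inv_anti₀ (Real.exp_pos _)
    set x := Real.exp (((kk j : ℝ) ^ 2 - K ^ 2) * ω ^ 2 / 2) with hx
    have hx0 : 0 < x := Real.exp_pos _
    have h1 : x ^ 2 = Real.exp (((kk j : ℝ) ^ 2 - K ^ 2) * ω ^ 2) := by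
      rw [hx, ← Real.exp_nat_mul]; congr 1; push_cast; ring
    have h2 : Real.exp (ω ^ 2 * ((j : ℝ) / 2 - K)) ≤ x ^ 2 := by
      rw [h1, Real.exp_le_exp, mul_comm]
      apply mul_le_mul_of_nonneg_right _ (by positivity)
      nlinarith
    nlinarith

lemma exp_geom (ω : ℝ) (c : ℝ) (j : ℕ) :
    Real.exp (-(ω ^ 2 * ((j : ℝ) / 2 - c))) = Real.exp (ω ^ 2 * c) * Real.exp (-(ω ^ 2 / 2)) ^ j := by
  rw [← Real.exp_nat_mul, ← Real.exp_add]; congr 1; ring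

lemma geom_summable {c : ℝ} (hc : 0 < c) : Summable (fun j : ℕ => Real.exp (-c) ^ j) :=
  summable_geometric_of_lt_one (Real.exp_pos _).le (by rw [Real.exp_lt_one_iff]; linarith)

lemma term_summable {ω K : ℝ} (hω : 0 < ω) (hK : 1 ≤ K) :
    Summable (fun j : ℕ => ((1 + lamK ω K * bet ω j) ^ 2)⁻¹) := by
  refine Summable.of_nonneg_of_le (fun j => by positivity) (term_le hK) ?_
  simp_rw [exp_geom]
  exact (geom_summable (by positivity)).mul_left _

lemma VV_le {ω K : ℝ} (hω : 0 < ω) (hK : 1 ≤ K) :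
    VV ω (lamK ω K) ≤ 2 * K + (1 + ∑' j : ℕ, Real.exp (-(ω ^ 2 / 2)) ^ j) := by
  unfold VV
  have hs := term_summable hω hK
  rw [← hs.sum_add_tsum_nat_add ⌈2 * K⌉₊]
  have h1 : ∑ j ∈ Finset.range ⌈2 * K⌉₊, ((1 + lamK ω K * bet ω j) ^ 2)⁻¹
      ≤ (⌈2 * K⌉₊ : ℝ) := by
    have := Finset.sum_le_sum (fun j (_ : j ∈ Finset.range ⌈2 * K⌉₊) => term_le_one ω K j)
    simpa using this
  have h2 := (Nat.ceil_lt_add_one (show 0 ≤ 2 * K by linarith)).le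
  have h3 : ∑' j : ℕ, ((1 + lamK ω K * bet ω (j + ⌈2 * K⌉₊)) ^ 2)⁻¹
      ≤ ∑' j : ℕ, Real.exp (-(ω ^ 2 / 2)) ^ j := by
    have hs' := (summable_nat_add_iff (f := fun j : ℕ => ((1 + lamK ω K * bet ω j) ^ 2)⁻¹)
      ⌈2 * K⌉₊).2 hs
    refine Summable.tsum_le_tsum (fun j => ?_) hs'
      (geom_summable (c := ω ^ 2 / 2) (by positivity))
    refine (term_le hK _).trans ?_
    rw [← Real.exp_nat_mul, Real.exp_le_exp]
    have := Nat.le_ceil (2 * K)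
    push_cast
    nlinarith [mul_nonneg (sq_nonneg ω) (sub_nonneg.2 this)]
  linarith

lemma term_ge {ω K : ℝ} (hK : 1 ≤ K) (j : ℕ) (hj : j < ⌊2 * K⌋₊) :
    1 - 2 * Real.exp (-(ω ^ 2 / 4)) ^ (⌊2 * K⌋₊ - 1 - j) ≤ ((1 + lamK ω K * bet ω j) ^ 2)⁻¹ := by
  have hx0 := mul_pos (lamK_pos ω K) (bet_pos ω j)
  have hle : lamK ω K * bet ω j ≤ Real.exp (-(ω ^ 2 / 4)) ^ (⌊2 * K⌋₊ - 1 - j) := by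
    rw [lamK_mul, ← Real.exp_nat_mul, Real.exp_le_exp]
    obtain ⟨d, hd⟩ := Nat.exists_eq_add_of_lt hj
    have e : ⌊2 * K⌋₊ - 1 - j = d := by omega
    rw [e]
    have hf := Nat.floor_le (show 0 ≤ 2 * K by linarith)
    rw [hd] at hf
    push_cast at hf
    have hk := kk_upper j
    have hk0 : (0 : ℝ) ≤ kk j := by positivity
    have hd0 : (0 : ℝ) ≤ d := by positivity
    have h1 : (d : ℝ) / 2 ≤ K - kk j := by linarith
    have h2 : (d : ℝ) / 2 ≤ K ^ 2 - (kk j : ℝ) ^ 2 := by nlinarith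
    nlinarith [mul_nonneg (sq_nonneg ω) (sub_nonneg.2 h2)]
  set x := lamK ω K * bet ω j
  have : 1 - 2 * x ≤ ((1 + x) ^ 2)⁻¹ := by
    rw [← one_div, le_div_iff₀ (by positivity)]
    nlinarith [pow_pos hx0 2, pow_pos hx0 3]
  linarith

lemma VV_ge {ω K : ℝ} (hω : 0 < ω) (hK : 1 ≤ K) :
    2 * K - (1 + 2 * ∑' j : ℕ, Real.exp (-(ω ^ 2 / 4)) ^ j) ≤ VV ω (lamK ω K) := by
  unfold VV
  have hs := term_summable hω hK
  have h1 := hs.sum_le_tsum (Finset.range ⌊2 * K⌋₊) (fun j _ => by positivity)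
  have h2 := Finset.sum_le_sum
    (fun j (hj : j ∈ Finset.range ⌊2 * K⌋₊) => term_ge (ω := ω) hK j (Finset.mem_range.1 hj))
  rw [Finset.sum_sub_distrib, ← Finset.mul_sum,
    Finset.sum_range_reflect (fun i => Real.exp (-(ω ^ 2 / 4)) ^ i)] at h2
  have h3 := (geom_summable (show 0 < ω ^ 2 / 4 by positivity)).sum_le_tsum
    (Finset.range ⌊2 * K⌋₊) (fun j _ => by positivity)
  have h4 := (Nat.lt_floor_add_one (2 * K)).le
  simp only [Finset.sum_const, Finset.card_range, nsmul_eq_mul, mul_one] at h2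
  linarith

lemma VV_tendsto {ω : ℝ} (hω : 0 < ω) :
    Tendsto (fun K : ℝ => VV ω (lamK ω K) / K) atTop (nhds 2) := by
  set c1 := 1 + 2 * ∑' j : ℕ, Real.exp (-(ω ^ 2 / 4)) ^ j
  set c2 := 1 + ∑' j : ℕ, Real.exp (-(ω ^ 2 / 2)) ^ j
  have l1 : Tendsto (fun K : ℝ => 2 - c1 / K) atTop (nhds 2) := by
    simpa using (tendsto_const_nhds (x := (2 : ℝ))).sub (tendsto_id.const_div_atTop c1)
  have l2 : Tendsto (fun K : ℝ => 2 + c2 / K) atTop (nhds 2) := by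
    simpa using (tendsto_const_nhds (x := (2 : ℝ))).add (tendsto_id.const_div_atTop c2)
  refine tendsto_of_tendsto_of_tendsto_of_le_of_le' l1 l2 ?_ ?_
  · filter_upwards [eventually_ge_atTop 1] with K hK
    have hK0 : 0 < K := by linarith
    rw [le_div_iff₀ hK0, sub_mul, div_mul_cancel₀ _ hK0.ne']
    exact VV_ge hω hK
  · filter_upwards [eventually_ge_atTop 1] with K hK
    have hK0 : 0 < K := by linarith
    rw [div_le_iff₀ hK0, add_mul, div_mul_cancel₀ _ hK0.ne']
    exact VV_le hω hK

/-- Upper bound for the bias. -/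
lemma BB_le {ω m : ℝ} (hω : 0 < ω) (hm : 1 ≤ m) :
    ∀ᶠ K : ℝ in atTop, BB ω m (lamK ω K) * K ^ (2 * m) ≤ 1 := by
  have hlim : Tendsto (fun K : ℝ => K ^ (2 * m) * Real.exp (-(ω ^ 2 / 2) * K)) atTop (nhds 0) :=
    tendsto_rpow_mul_exp_neg_mul_atTop_nhds_zero _ _ (by positivity)
  filter_upwards [eventually_ge_atTop 1, hlim.eventually_le_const one_pos,
    eventually_ge_atTop (4 * m / ω ^ 2)] with K hK1 hKe hKm
  have hK0 : 0 < K := by linarith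
  have hp : 0 < K ^ (2 * m) := by positivity
  rw [← le_div_iff₀ hp]
  refine ciSup_le fun j => ?_
  unfold aa
  have hr := rho_ge_one m j
  rw [div_le_div_iff₀ (by linarith) hp, one_mul]
  have hq0 := ratio_nonneg (ω := ω) (lamK_pos ω K) j
  have hq1 := ratio_le_one (ω := ω) (lamK_pos ω K) j
  have hsq1 : (lamK ω K * bet ω j / (1 + lamK ω K * bet ω j)) ^ 2 ≤ 1 := pow_le_one₀ hq0 hq1
  have hk0 : (0 : ℝ) ≤ kk j := by positivity
  have hrk : (kk j : ℝ) ^ (2 * m) ≤ rho m j := by unfold rho; linarith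
  by_cases hkK : K ≤ kk j
  · have := Real.rpow_le_rpow hK0.le hkK (show 0 ≤ 2 * m by linarith)
    nlinarith
  push Not at hkK
  have hsq : (lamK ω K * bet ω j / (1 + lamK ω K * bet ω j)) ^ 2
      ≤ Real.exp (-((K ^ 2 - (kk j : ℝ) ^ 2) * ω ^ 2)) := by
    have hx0 := mul_pos (lamK_pos ω K) (bet_pos ω j)
    have h1 : lamK ω K * bet ω j / (1 + lamK ω K * bet ω j) ≤ lamK ω K * bet ω j :=
      div_le_self hx0.le (by linarith)
    refine (pow_le_pow_left₀ hq0 h1 2).trans (le_of_eq ?_)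
    rw [lamK_mul, ← Real.exp_nat_mul]
    congr 1; push_cast; ring
  by_cases hk2 : (kk j : ℝ) ≤ K / 2
  · have h1 : Real.exp (-((K ^ 2 - (kk j : ℝ) ^ 2) * ω ^ 2)) ≤ Real.exp (-(ω ^ 2 / 2) * K) := by
      rw [Real.exp_le_exp]
      have : K / 2 ≤ K ^ 2 - (kk j : ℝ) ^ 2 := by nlinarith
      nlinarith [mul_nonneg (sq_nonneg ω) (sub_nonneg.2 this)]
    have h2 := mul_le_mul_of_nonneg_right (hsq.trans h1) hp.le
    linarith
  · push Not at hk2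
    have hkp : (0 : ℝ) < kk j := by linarith
    have h1 : K ^ (2 * m) = (kk j : ℝ) ^ (2 * m) * Real.exp (2 * m * Real.log (K / kk j)) := by
      rw [mul_comm (2 * m) (Real.log _), ← Real.rpow_def_of_pos (by positivity),
        ← Real.mul_rpow hk0 (by positivity)]
      congr 1; field_simp
    have h2 : Real.log (K / kk j) ≤ K / kk j - 1 := Real.log_le_sub_one_of_pos (by positivity)
    have h3 : K / kk j - 1 = (K - kk j) / kk j := by field_simp
    have h4 : (K - kk j) / kk j ≤ (K - kk j) * (2 / K) := by
      rw [div_eq_mul_inv]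
      apply mul_le_mul_of_nonneg_left _ (by linarith)
      rw [inv_le_comm₀ hkp (by positivity)]
      rw [inv_div]; exact hk2.le
    have h5 : 4 * m / K ≤ ω ^ 2 * K := by
      rw [div_le_iff₀ (by positivity)] at hKm
      rw [div_le_iff₀ hK0]
      nlinarith
    have h6 : 2 * m * Real.log (K / kk j) ≤ (K ^ 2 - (kk j : ℝ) ^ 2) * ω ^ 2 := by
      calc 2 * m * Real.log (K / kk j) ≤ 2 * m * ((K - kk j) * (2 / K)) :=
            mul_le_mul_of_nonneg_left (by linarith) (by linarith)
        _ = (K - kk j) * (4 * m / K) := by ring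
        _ ≤ (K - kk j) * (ω ^ 2 * K) := mul_le_mul_of_nonneg_left h5 (by linarith)
        _ ≤ _ := by nlinarith [mul_nonneg (mul_nonneg (sq_nonneg ω) (sub_nonneg.2 hkK.le)) hk0]
    calc _ ≤ Real.exp (-((K ^ 2 - (kk j : ℝ) ^ 2) * ω ^ 2)) * K ^ (2 * m) :=
          mul_le_mul_of_nonneg_right hsq hp.le
      _ = (kk j : ℝ) ^ (2 * m) * Real.exp (-((K ^ 2 - (kk j : ℝ) ^ 2) * ω ^ 2)
            + 2 * m * Real.log (K / kk j)) := by rw [h1, Real.exp_add]; ring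
      _ ≤ (kk j : ℝ) ^ (2 * m) * 1 := by
          apply mul_le_mul_of_nonneg_left _ (by positivity)
          rw [Real.exp_le_one_iff]; linarith
      _ ≤ rho m j := by linarith

lemma BB_ge {ω m K : ℝ} (hω : 0 < ω) (hm : 1 ≤ m) (hK : 1 ≤ K) :
    (1 - Real.exp (-(ω ^ 2 * K))) ^ 2 * (K ^ (2 * m) / (1 + (K + 2) ^ (2 * m)))
      ≤ BB ω m (lamK ω K) * K ^ (2 * m) := by
  set k := ⌈K + 1⌉₊ with hk
  have hkk : kk (2 * k) = k := by unfold kk; omega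
  have h1 : K + 1 ≤ k := Nat.le_ceil _
  have h2 : (k : ℝ) ≤ K + 2 := by
    have := (Nat.ceil_lt_add_one (show 0 ≤ K + 1 by linarith)).le
    linarith
  have hp : 0 < K ^ (2 * m) := by positivity
  have h3 := aa_le_BB (ω := ω) (m := m) (lamK_pos ω K) (2 * k)
  refine le_trans ?_ (mul_le_mul_of_nonneg_right h3 hp.le)
  unfold aa
  have hx0 := mul_pos (lamK_pos ω K) (bet_pos ω (2 * k))
  have hx : Real.exp (ω ^ 2 * K) ≤ lamK ω K * bet ω (2 * k) := by
    rw [lamK_mul, hkk, Real.exp_le_exp]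
    have : 2 * K ≤ (k : ℝ) ^ 2 - K ^ 2 := by nlinarith
    nlinarith [mul_nonneg (sq_nonneg ω) (sub_nonneg.2 this)]
  set x := lamK ω K * bet ω (2 * k)
  have h4 : 1 - Real.exp (-(ω ^ 2 * K)) ≤ x / (1 + x) := by
    have : x / (1 + x) = 1 - (1 + x)⁻¹ := by field_simp; ring
    rw [this, Real.exp_neg]
    have := inv_anti₀ (Real.exp_pos _) (show Real.exp (ω ^ 2 * K) ≤ 1 + x by linarith)
    linarith
  have h5 : 0 ≤ 1 - Real.exp (-(ω ^ 2 * K)) := by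
    have : Real.exp (-(ω ^ 2 * K)) ≤ 1 := by
      rw [Real.exp_le_one_iff]
      have : 0 ≤ ω ^ 2 * K := by positivity
      linarith
    linarith
  have h6 : rho m (2 * k) ≤ 1 + (K + 2) ^ (2 * m) := by
    unfold rho; rw [hkk]
    have := Real.rpow_le_rpow (by positivity) h2 (show 0 ≤ 2 * m by linarith)
    linarith
  have h7 := rho_ge_one m (2 * k)
  rw [div_mul_eq_mul_div, mul_div_assoc]
  apply mul_le_mul (pow_le_pow_left₀ h5 h4 2) _ (by positivity) (by positivity)
  exact div_le_div_of_nonneg_left hp.le (by linarith) h6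

lemma BB_tendsto {ω m : ℝ} (hω : 0 < ω) (hm : 1 ≤ m) :
    Tendsto (fun K : ℝ => BB ω m (lamK ω K) * K ^ (2 * m)) atTop (nhds 1) := by
  have l1 : Tendsto (fun K : ℝ => Real.exp (-(ω ^ 2 * K))) atTop (nhds 0) :=
    Real.tendsto_exp_neg_atTop_nhds_zero.comp (tendsto_id.const_mul_atTop (by positivity))
  have l2 : Tendsto (fun K : ℝ => (K ^ (2 * m))⁻¹ + (1 + 2 / K) ^ (2 * m)) atTop (nhds 1) := by
    have a := (tendsto_rpow_atTop (show 0 < 2 * m by linarith)).inv_tendsto_atTop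
    have b : Tendsto (fun K : ℝ => 1 + 2 / K) atTop (nhds 1) := by
      simpa using (tendsto_const_nhds (x := (1 : ℝ))).add (tendsto_id.const_div_atTop 2)
    have c := b.rpow_const (p := 2 * m) (Or.inl one_ne_zero)
    simpa using a.add c
  have l3 : Tendsto (fun K : ℝ => K ^ (2 * m) / (1 + (K + 2) ^ (2 * m))) atTop (nhds 1) := by
    have := l2.inv₀ one_ne_zero
    rw [inv_one] at this
    refine this.congr' ?_
    filter_upwards [eventually_ge_atTop 1] with K hK
    have hK0 : 0 < K := by linarith
    have : (1 + 2 / K) ^ (2 * m) = (K + 2) ^ (2 * m) / K ^ (2 * m) := by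
      rw [← Real.div_rpow (by linarith) hK0.le]; congr 1; field_simp
    rw [this, ← one_div (K ^ (2 * m)), ← add_div, inv_div]
  have l4 : Tendsto (fun K : ℝ => (1 - Real.exp (-(ω ^ 2 * K))) ^ 2 *
      (K ^ (2 * m) / (1 + (K + 2) ^ (2 * m)))) atTop (nhds 1) := by
    simpa using ((l1.const_sub 1).pow 2).mul l3
  refine tendsto_of_tendsto_of_tendsto_of_le_of_le' l4 tendsto_const_nhds ?_ (BB_le hω hm)
  filter_upwards [eventually_ge_atTop 1] with K hK using BB_ge hω hm hK

/-- The limiting constant. -/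
noncomputable def CC (Q m : ℝ) : ℝ :=
  (2 * m + 1) * m ^ (-(2 * m / (2 * m + 1))) * Q ^ (1 / (2 * m + 1))

lemma CC_eq {Q m : ℝ} (hQ : 0 < Q) (hm : 1 ≤ m) :
    CC Q m = 2 * (m * Q) ^ (1 / (2 * m + 1)) + Q * ((m * Q) ^ (1 / (2 * m + 1))) ^ (-(2 * m)) := by
  have hm0 : 0 < m := by linarith
  have h1 : ((m * Q) ^ (1 / (2 * m + 1))) ^ (-(2 * m)) = (m * Q) ^ (-(2 * m / (2 * m + 1))) := by
    rw [← Real.rpow_mul (by positivity)]; congr 1; ring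
  have h2 : (m * Q) ^ (1 / (2 * m + 1)) = (m * Q) * (m * Q) ^ (-(2 * m / (2 * m + 1))) := by
    rw [← Real.rpow_one_add' (by positivity)]
    · congr 1; field_simp; ring
    · have : 1 + -(2 * m / (2 * m + 1)) = 1 / (2 * m + 1) := by field_simp; ring
      rw [this]; positivity
  have h3 : Q ^ (1 / (2 * m + 1)) = Q * Q ^ (-(2 * m / (2 * m + 1))) := by
    rw [← Real.rpow_one_add' hQ.le]
    · congr 1; field_simp; ring
    · have : 1 + -(2 * m / (2 * m + 1)) = 1 / (2 * m + 1) := by field_simp; ring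
      rw [this]; positivity
  rw [h1, h2, Real.mul_rpow hm0.le hQ.le, CC, h3]
  ring

lemma CC_pos {Q m : ℝ} (hQ : 0 < Q) (hm : 1 ≤ m) : 0 < CC Q m := by
  unfold CC; positivity

lemma CC_min {Q m y : ℝ} (hQ : 0 < Q) (hm : 1 ≤ m) (hy : 0 < y) :
    CC Q m ≤ 2 * y + Q * y ^ (-(2 * m)) := by
  have hm0 : 0 < m := by linarith
  rw [CC_eq hQ hm]
  set κ := (m * Q) ^ (1 / (2 * m + 1)) with hκ
  have hκ0 : 0 < κ := by positivity
  have hκm : κ = m * Q * κ ^ (-(2 * m)) := by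
    have : κ ^ (2 * m + 1) = m * Q := by
      rw [hκ, ← Real.rpow_mul (by positivity), one_div_mul_cancel (by positivity), Real.rpow_one]
    rw [← this, ← Real.rpow_add hκ0]
    rw [show 2 * m + 1 + -(2 * m) = 1 by ring, Real.rpow_one]
  obtain ⟨t, ht0, rfl⟩ : ∃ t, 0 < t ∧ y = κ * t := ⟨y / κ, by positivity, by field_simp⟩
  rw [Real.mul_rpow hκ0.le ht0.le]
  have h1 : 1 - 2 * m * (t - 1) ≤ t ^ (-(2 * m)) := by
    rw [Real.rpow_def_of_pos ht0]
    have a := Real.add_one_le_exp (Real.log t * -(2 * m))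
    have b := Real.log_le_sub_one_of_pos ht0
    nlinarith
  set g := κ ^ (-(2 * m))
  have hg : 0 < g := by positivity
  have h2 := mul_le_mul_of_nonneg_left h1 (mul_pos hQ hg).le
  have h3 : 2 * (κ * t) = 2 * (m * Q * g) * t := by rw [← hκm]; ring
  rw [h3]
  have h4 : 2 * κ = 2 * (m * Q * g) := by rw [← hκm]
  rw [h4]
  nlinarith

lemma scaled {m Q V B K : ℝ} (hm : 1 ≤ m) (hK : 0 < K) (n : ℕ) (hn : 1 ≤ n) :
    (n : ℝ) ^ (2 * m / (2 * m + 1)) * ((1 / n) * V + Q * B) =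
      (V / K) * (K / (n : ℝ) ^ (1 / (2 * m + 1))) +
      Q * (B * K ^ (2 * m)) * (K / (n : ℝ) ^ (1 / (2 * m + 1))) ^ (-(2 * m)) := by
  have hn0 : (0 : ℝ) < n := by exact_mod_cast hn
  have hm0 : 0 < m := by linarith
  have h1 : (n : ℝ) ^ (2 * m / (2 * m + 1)) = n / (n : ℝ) ^ (1 / (2 * m + 1)) := by
    rw [eq_div_iff (by positivity), ← Real.rpow_add hn0]
    rw [show 2 * m / (2 * m + 1) + 1 / (2 * m + 1) = 1 by field_simp, Real.rpow_one]
  have h2 : (K / (n : ℝ) ^ (1 / (2 * m + 1))) ^ (-(2 * m))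
      = (K ^ (2 * m))⁻¹ * (n : ℝ) ^ (2 * m / (2 * m + 1)) := by
    rw [Real.div_rpow hK.le (by positivity), ← Real.rpow_mul hn0.le, Real.rpow_neg hK.le,
      div_eq_mul_inv, ← Real.rpow_neg hn0.le]
    congr 2; ring
  rw [h2, mul_add]
  have hp : 0 < K ^ (2 * m) := by positivity
  congr 1
  · rw [h1]; field_simp
  · field_simp

lemma sup_tendsto {ω Q m : ℝ} (hω : 0 < ω) (hQ : 0 < Q) (hm : 1 ≤ m) (K : ℕ → ℝ)
    (hK : Tendsto (fun n : ℕ => K n / (n : ℝ) ^ (1 / (2 * m + 1))) atTop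
      (nhds ((m * Q) ^ (1 / (2 * m + 1))))) :
    Tendsto (fun n : ℕ => (n : ℝ) ^ (2 * m / (2 * m + 1)) *
      ((1 / n) * VV ω (lamK ω (K n)) + Q * BB ω m (lamK ω (K n)))) atTop (nhds (CC Q m)) := by
  have hm0 : 0 < m := by linarith
  have hκ0 : 0 < (m * Q) ^ (1 / (2 * m + 1)) := by positivity
  have hnr : Tendsto (fun n : ℕ => (n : ℝ) ^ (1 / (2 * m + 1))) atTop atTop :=
    (tendsto_rpow_atTop (by positivity)).comp tendsto_natCast_atTop_atTop
  have hKtop : Tendsto K atTop atTop := by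
    refine (hK.pos_mul_atTop hκ0 hnr).congr' ?_
    filter_upwards [eventually_ge_atTop 1] with n hn
    have hn0 : (0 : ℝ) < n := by exact_mod_cast hn
    field_simp
  have h1 := (VV_tendsto hω).comp hKtop
  have h2 := (BB_tendsto hω hm).comp hKtop
  have h3 := (h1.mul hK).add ((h2.const_mul Q).mul (hK.rpow_const (p := -(2 * m)) (Or.inl hκ0.ne')))
  rw [mul_one, ← CC_eq hQ hm] at h3
  refine h3.congr' ?_
  filter_upwards [eventually_ge_atTop 1, hKtop.eventually_gt_atTop 0] with n hn hKn
  exact (scaled hm hKn n hn).symm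

lemma lower_bound {ω Q m : ℝ} (hω : 0 < ω) (hQ : 0 < Q) (hm : 1 ≤ m) {ε : ℝ} (hε : 0 < ε)
    (hε1 : ε < 1) :
    ∀ᶠ n : ℕ in atTop, ∀ lam : ℝ, 0 < lam → (1 - ε) * CC Q m ≤
      (n : ℝ) ^ (2 * m / (2 * m + 1)) * ((1 / n) * VV ω lam + Q * BB ω m lam) := by
  have hm0 : 0 < m := by linarith
  have e1 := (VV_tendsto hω).eventually_const_le (show 2 * (1 - ε) < 2 by linarith)
  have e2 := (BB_tendsto hω hm).eventually_const_le (show 1 - ε < 1 by linarith)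
  obtain ⟨K0, hK0⟩ := eventually_atTop.1 (e1.and (e2.and (eventually_gt_atTop 0)))
  set K1 := max K0 0 with hK1
  set c := (lamK ω K1 / (1 + lamK ω K1)) ^ 2 with hc
  have hl1 := lamK_pos ω K1
  have hc0 : 0 < c := by positivity
  have hnp : Tendsto (fun n : ℕ => (n : ℝ) ^ (2 * m / (2 * m + 1))) atTop atTop :=
    (tendsto_rpow_atTop (by positivity)).comp tendsto_natCast_atTop_atTop
  have hC := CC_pos hQ hm
  filter_upwards [eventually_ge_atTop 1, hnp.eventually_ge_atTop (CC Q m / (Q * c))] with n hn hnc lam hlam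
  have hn0 : (0 : ℝ) < n := by exact_mod_cast hn
  by_cases hcase : lam ≤ lamK ω K1
  · -- parametrise `lam` by its frequency cut-off
    have hlog : K1 ^ 2 * ω ^ 2 / 2 ≤ -Real.log lam := by
      have := Real.log_le_log hlam hcase
      rw [lamK, Real.log_exp] at this
      linarith
    have hs0 : 0 ≤ 2 * (-Real.log lam) / ω ^ 2 := by
      have : 0 ≤ K1 ^ 2 * ω ^ 2 / 2 := by positivity
      have : 0 ≤ -Real.log lam := by linarith
      positivity
    set K := √(2 * (-Real.log lam) / ω ^ 2) with hKdef
    have hKsq : K ^ 2 = 2 * (-Real.log lam) / ω ^ 2 := Real.sq_sqrt hs0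
    have hKlam : lam = lamK ω K := by
      rw [lamK, hKsq]
      have : -(2 * -Real.log lam / ω ^ 2 * ω ^ 2 / 2) = Real.log lam := by field_simp
      rw [this, Real.exp_log hlam]
    have hKK : K1 ≤ K := by
      apply Real.le_sqrt_of_sq_le
      rw [le_div_iff₀ (by positivity)]
      linarith
    obtain ⟨f1, f2, f3⟩ := hK0 K ((le_max_left _ _).trans hKK)
    rw [hKlam, scaled hm f3 n hn]
    set y := K / (n : ℝ) ^ (1 / (2 * m + 1))
    have hy : 0 < y := by positivity
    have hmin := CC_min hQ hm hy
    have hyp : 0 < y ^ (-(2 * m)) := by positivity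
    have g1 := mul_le_mul_of_nonneg_right f1 hy.le
    have g2 := mul_le_mul_of_nonneg_right f2 (mul_pos hQ hyp).le
    have g3 := mul_le_mul_of_nonneg_left hmin (show 0 ≤ 1 - ε by linarith)
    nlinarith
  · push Not at hcase
    have hb0 : bet ω 0 = 1 := by simp [bet, kk]
    have hr0 : rho m 0 = 1 := by
      simp only [rho, kk]; norm_num; exact Real.zero_rpow (by positivity)
    have h1 : c ≤ aa ω m lam 0 := by
      rw [aa, hb0, hr0, mul_one, div_one, hc]
      apply pow_le_pow_left₀ (by positivity)
      rw [div_le_div_iff₀ (by positivity) (by positivity)]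
      nlinarith
    have h2 := h1.trans (aa_le_BB hlam 0)
    have h3 : CC Q m ≤ (n : ℝ) ^ (2 * m / (2 * m + 1)) * (Q * c) := by
      rwa [div_le_iff₀ (by positivity)] at hnc
    have h4 : 0 ≤ (1 / (n : ℝ)) * VV ω lam := by
      have := VV_nonneg ω lam
      positivity
    have h5 : (n : ℝ) ^ (2 * m / (2 * m + 1)) * (Q * c) ≤
        (n : ℝ) ^ (2 * m / (2 * m + 1)) * ((1 / n) * VV ω lam + Q * BB ω m lam) := by
      apply mul_le_mul_of_nonneg_left _ (by positivity)
      nlinarith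
    nlinarith

lemma kn_tendsto {Q m : ℝ} (hQ : 0 < Q) (hm : 1 ≤ m) :
    ∀ n : ℕ, 1 ≤ n → (m * n * Q) ^ (1 / (2 * m + 1)) / (n : ℝ) ^ (1 / (2 * m + 1))
      = (m * Q) ^ (1 / (2 * m + 1)) := by
  intro n hn
  have hn0 : (0 : ℝ) < n := by exact_mod_cast hn
  rw [← Real.div_rpow (by positivity) hn0.le]
  congr 1; field_simp

lemma main_inf {ω Q m : ℝ} (hω : 0 < ω) (hQ : 0 < Q) (hm : 1 ≤ m) :
    Tendsto (fun n : ℕ => (n : ℝ) ^ (2 * m / (2 * m + 1)) *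
        sInf ((fun l : ℝ => ⨆ θ ∈ ellipsoid (rho m) Q, regRisk (bet ω) n l θ) '' Set.Ioi 0))
      atTop (nhds (CC Q m)) := by
  have hm0 : 0 < m := by linarith
  have hC := CC_pos hQ hm
  have hup := sup_tendsto hω hQ hm (fun n : ℕ => (m * n * Q) ^ (1 / (2 * m + 1))) (by
    refine tendsto_const_nhds.congr' ?_
    filter_upwards [eventually_ge_atTop 1] with n hn using (kn_tendsto hQ hm n hn).symm)
  have himg : ∀ n : ℕ, (fun l : ℝ => ⨆ θ ∈ ellipsoid (rho m) Q, regRisk (bet ω) n l θ) '' Set.Ioi 0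
      = (fun l : ℝ => (1 / n) * VV ω l + Q * BB ω m l) '' Set.Ioi 0 := fun n =>
    Set.image_congr fun l hl => sup_risk hQ hl n
  simp_rw [himg]
  rw [tendsto_order]
  constructor
  · intro a ha
    obtain ⟨ε, hε, hε1, hεa⟩ : ∃ ε : ℝ, 0 < ε ∧ ε < 1 ∧ a < (1 - ε) * CC Q m := by
      have hlim : Tendsto (fun ε : ℝ => (1 - ε) * CC Q m) (nhdsWithin 0 (Set.Ioi 0))
          (nhds (CC Q m)) := by
        have : Continuous (fun ε : ℝ => (1 - ε) * CC Q m) := by fun_prop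
        simpa using (this.tendsto 0).mono_left nhdsWithin_le_nhds
      have h1 := hlim.eventually_const_lt ha
      have h2 : ∀ᶠ ε : ℝ in nhdsWithin 0 (Set.Ioi 0), ε ∈ Set.Ioo (0 : ℝ) 1 :=
        Ioo_mem_nhdsGT one_pos
      obtain ⟨ε, h⟩ := (h1.and h2).exists
      exact ⟨ε, h.2.1, h.2.2, h.1⟩
    filter_upwards [lower_bound hω hQ hm hε hε1, eventually_ge_atTop 1] with n hn hn1
    have hn0 : (0 : ℝ) < n := by exact_mod_cast hn1
    refine hεa.trans_le ?_
    rw [← div_le_iff₀' (by positivity)]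
    apply le_csInf (Set.Nonempty.image _ ⟨1, one_pos⟩)
    rintro _ ⟨l, hl, rfl⟩
    rw [div_le_iff₀' (by positivity)]
    exact hn l hl
  · intro a ha
    filter_upwards [hup.eventually_lt_const ha] with n hn
    refine lt_of_le_of_lt ?_ hn
    apply mul_le_mul_of_nonneg_left _ (by positivity)
    apply csInf_le
    · refine ⟨0, ?_⟩
      rintro _ ⟨l, hl, rfl⟩
      have := VV_nonneg ω l
      have := BB_nonneg (ω := ω) (m := m) hl
      positivity
    · exact ⟨_, lamK_pos ω _, rfl⟩

lemma main_seq {ω Q m : ℝ} (hω : 0 < ω) (hQ : 0 < Q) (hm : 1 ≤ m) (lam : ℕ → ℝ)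
    (hlam : ∀ n : ℕ, lam n ∈ Set.Ioo (0 : ℝ) 1)
    (h : Tendsto (fun n : ℕ =>
          (Real.log (1 / lam n) / ω ^ 2) / (((m * n * Q) ^ (2 / (2 * m + 1))) / 2))
        atTop (nhds 1)) :
    Tendsto (fun n : ℕ => (n : ℝ) ^ (2 * m / (2 * m + 1)) *
          ⨆ θ ∈ ellipsoid (rho m) Q, regRisk (bet ω) n (lam n) θ)
        atTop (nhds (CC Q m)) := by
  have hm0 : 0 < m := by linarith
  set K : ℕ → ℝ := fun n => √(2 * Real.log (1 / lam n) / ω ^ 2) with hKdef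
  have hlog : ∀ n, 0 ≤ Real.log (1 / lam n) := fun n =>
    Real.log_nonneg (by rw [le_div_iff₀ (hlam n).1]; linarith [(hlam n).2])
  have hKlam : ∀ n, lam n = lamK ω (K n) := by
    intro n
    have := hlog n
    rw [lamK, Real.sq_sqrt (by positivity)]
    have : -(2 * Real.log (1 / lam n) / ω ^ 2 * ω ^ 2 / 2) = Real.log (lam n) := by
      rw [one_div, Real.log_inv]; field_simp
    rw [this, Real.exp_log (hlam n).1]
  have hK : Tendsto (fun n : ℕ => K n / (n : ℝ) ^ (1 / (2 * m + 1))) atTop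
      (nhds ((m * Q) ^ (1 / (2 * m + 1)))) := by
    have h1 := (h.sqrt).mul_const ((m * Q) ^ (1 / (2 * m + 1)))
    rw [Real.sqrt_one, one_mul] at h1
    refine h1.congr' ?_
    filter_upwards [eventually_ge_atTop 1] with n hn
    have hn0 : (0 : ℝ) < n := by exact_mod_cast hn
    rw [← kn_tendsto hQ hm n hn]
    have hsq : (m * n * Q) ^ (2 / (2 * m + 1)) = ((m * n * Q) ^ (1 / (2 * m + 1))) ^ 2 := by
      rw [← Real.rpow_mul_natCast (by positivity)]; congr 1; push_cast; ring
    have hg : 0 < (m * n * Q) ^ (1 / (2 * m + 1)) := by positivity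
    have hh : 0 < (n : ℝ) ^ (1 / (2 * m + 1)) := by positivity
    rw [hsq]
    have e : (Real.log (1 / lam n) / ω ^ 2) / ((((m * n * Q) ^ (1 / (2 * m + 1))) ^ 2) / 2)
        = (2 * Real.log (1 / lam n) / ω ^ 2) / ((m * n * Q) ^ (1 / (2 * m + 1))) ^ 2 := by
      field_simp
    rw [e, Real.sqrt_div' _ (by positivity), Real.sqrt_sq hg.le]
    simp only [hKdef]
    field_simp
  refine (sup_tendsto hω hQ hm K hK).congr fun n => ?_
  rw [← hKlam n, sup_risk hQ (hlam n).1]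

/-- **Theorem 3.** Over the Sobolev ellipsoid `H^m(Q)`, `m ≥ 1`, the periodic Gaussian
regularization has minimax-λ maximal risk
`∼ (2m+1) m^{−2m/(2m+1)} Q^{1/(2m+1)} n^{−2m/(2m+1)}`, and this is achieved whenever
`log(1/λ_n)/ω² ∼ (m n Q)^{2/(2m+1)} / 2`. -/
theorem stmt_2 (ω Q m : ℝ) (hω : 0 < ω) (hQ : 0 < Q) (hm : 1 ≤ m)
    (β : ℕ → ℝ) (hβ0 : β 0 = 1)
    (hβodd : ∀ l : ℕ, 1 ≤ l → β (2 * l - 1) = Real.exp ((l : ℝ) ^ 2 * ω ^ 2 / 2))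
    (hβeven : ∀ l : ℕ, 1 ≤ l → β (2 * l) = Real.exp ((l : ℝ) ^ 2 * ω ^ 2 / 2))
    (ρ : ℕ → ℝ) (hρ0 : ρ 0 = 1)
    (hρodd : ∀ l : ℕ, 1 ≤ l → ρ (2 * l - 1) = 1 + (l : ℝ) ^ (2 * m))
    (hρeven : ∀ l : ℕ, 1 ≤ l → ρ (2 * l) = 1 + (l : ℝ) ^ (2 * m)) :
    Tendsto (fun n : ℕ => (n : ℝ) ^ (2 * m / (2 * m + 1)) *
        sInf ((fun l : ℝ => ⨆ θ ∈ ellipsoid ρ Q, regRisk β n l θ) '' Set.Ioi 0))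
      atTop (nhds ((2 * m + 1) * m ^ (-(2 * m / (2 * m + 1))) * Q ^ (1 / (2 * m + 1)))) ∧
    ∀ lam : ℕ → ℝ, (∀ n : ℕ, lam n ∈ Set.Ioo (0 : ℝ) 1) →
      Tendsto (fun n : ℕ =>
          (Real.log (1 / lam n) / ω ^ 2) / (((m * n * Q) ^ (2 / (2 * m + 1))) / 2))
        atTop (nhds 1) →
      Tendsto (fun n : ℕ => (n : ℝ) ^ (2 * m / (2 * m + 1)) *
          ⨆ θ ∈ ellipsoid ρ Q, regRisk β n (lam n) θ)
        atTop (nhds ((2 * m + 1) * m ^ (-(2 * m / (2 * m + 1))) * Q ^ (1 / (2 * m + 1)))) := by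
  have hm0 : 0 < m := by linarith
  have hβ : β = bet ω := by
    funext j
    obtain ⟨l, hl⟩ := Nat.even_or_odd' j
    rcases hl with rfl | rfl
    · rcases Nat.eq_zero_or_pos l with rfl | hl
      · simp [hβ0, bet, kk]
      · rw [hβeven l hl, bet, show kk (2 * l) = l by unfold kk; omega]
    · have := hβodd (l + 1) (by omega)
      rw [show 2 * (l + 1) - 1 = 2 * l + 1 by omega] at this
      rw [this, bet, show kk (2 * l + 1) = l + 1 by unfold kk; omega]
  have hρ : ρ = rho m := by
    funext j
    obtain ⟨l, hl⟩ := Nat.even_or_odd' j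
    rcases hl with rfl | rfl
    · rcases Nat.eq_zero_or_pos l with rfl | hl
      · rw [mul_zero, hρ0]
        simp only [rho, kk]
        norm_num
        exact Real.zero_rpow (by positivity)
      · rw [hρeven l hl, rho, show kk (2 * l) = l by unfold kk; omega]
    · have := hρodd (l + 1) (by omega)
      rw [show 2 * (l + 1) - 1 = 2 * l + 1 by omega] at this
      rw [this, rho, show kk (2 * l + 1) = l + 1 by unfold kk; omega]
  subst hβ hρ
  exact ⟨main_inf hω hQ hm, fun lam hlam h => main_seq hω hQ hm lam hlam h⟩
end
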